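/- arXiv:2208.08030 — 9 statements merged into one kernel-verified Lean document; each statement's English description precedes it below -/
import Mathlib

section
/- Let a ∈ (−1, 1] and let x ∈ (−1/2, ∞) with x ≠ 0. Define h(x; a) = x / ( (x + 1/2)² + a(x + 1/2) + 1/4 ). Then h(x; a) ≠ 0 and the reciprocal 1/h(x; a) does not lie in the open interval ( 1 + a − √(2(1 + a)), 1 + a + √(2(1 + a)) ); equivalently, either 1/h(x; a) ≤ 1 + a − √(2(1+a)) or 1/h(x; a) ≥ 1 + a + √(2(1+a)). -/
/-- `h(x; a) = x / ((x + 1/2)² + a(x + 1/2) + 1/4)`. -/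
noncomputable def hFun (x a : ℝ) : ℝ :=
  x / ((x + 1 / 2) ^ 2 + a * (x + 1 / 2) + 1 / 4)

theorem quadratic_denominator_pos {a y : ℝ} (ha : -1 < a) (hy : 0 < y) :
    0 < y ^ 2 + a * y + 1 / 4 := by
  nlinarith [sq_nonneg (y - 1 / 2), mul_pos (neg_lt_iff_pos_add.mp ha) hy]

theorem one_div_hFun {a x : ℝ} (hx : x ≠ 0) :
    1 / hFun x a = x + (1 + a) + (1 + a) / (2 * x) := by
  rw [hFun, one_div_div]
  field_simp
  ring

/-- For `a ∈ (−1, 1]` and `x ∈ (−1/2, ∞)`, `x ≠ 0`, one has `h(x;a) ≠ 0`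
and `1/h(x;a)` does not lie in `(1 + a − √(2(1+a)), 1 + a + √(2(1+a)))`:
either `1/h(x;a) ≤ 1 + a − √(2(1+a))` or `1/h(x;a) ≥ 1 + a + √(2(1+a))`. -/
theorem stmt_1 (a x : ℝ) (ha : a ∈ Set.Ioc (-1 : ℝ) 1)
    (hx : x ∈ Set.Ioi (-(1 / 2) : ℝ)) (hx0 : x ≠ 0) :
    hFun x a ≠ 0 ∧
      (1 / hFun x a ≤ 1 + a - Real.sqrt (2 * (1 + a)) ∨
        1 / hFun x a ≥ 1 + a + Real.sqrt (2 * (1 + a))) := by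
  have hD := quadratic_denominator_pos ha.1 (neg_lt_iff_pos_add.mp hx)
  refine ⟨div_ne_zero hx0 hD.ne', ?_⟩
  rw [one_div_hFun hx0]
  have hs : Real.sqrt (2 * (1 + a)) ^ 2 = 2 * (1 + a) :=
    Real.sq_sqrt (by linarith [ha.1])
  set s := Real.sqrt (2 * (1 + a))
  have ha_eq : 1 + a = s ^ 2 / 2 := by linarith
  rw [ha_eq]
  rcases hx0.lt_or_gt with h | h
  · left
    have key : x + s ^ 2 / 2 + s ^ 2 / 2 / (2 * x) - (s ^ 2 / 2 - s) =
        (2 * x + s) ^ 2 / (4 * x) := by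
      field_simp
      ring
    have := div_nonpos_of_nonneg_of_nonpos (sq_nonneg (2 * x + s)) (by linarith : 4 * x ≤ 0)
    linarith
  · right
    have key : x + s ^ 2 / 2 + s ^ 2 / 2 / (2 * x) - (s ^ 2 / 2 + s) =
        (2 * x - s) ^ 2 / (4 * x) := by
      field_simp
      ring
    have := div_nonneg (sq_nonneg (2 * x - s)) (by linarith : 0 ≤ 4 * x)
    linarith
end

section
/- Let ξ < −1/4 and let φ ∈ (0, π/4) satisfy √(2(cos 2φ + 1)) > −1 + √(1 − 2/ξ). Set C(φ) = 1/( 1 + cos 2φ + √(2(1 + cos 2φ)) ). Then for every k = u + iv with v ≥ 0 and v ≤ |u|·tan φ (i.e. k ∈ Υ₁ ∪ Υ₂), one has Im θ_ξ(k) ≤ (Im k)·( ξ + C(φ) ); and for every k = u + iv with v ≤ 0 and |v| ≤ |u|·tan φ (i.e. k ∈ Υ₃ ∪ Υ₄), one has Im θ_ξ(k) ≥ (Im k)·( ξ + C(φ) ). -/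
/-- The phase function of the Camassa–Holm Riemann–Hilbert problem:
`θ_ξ(k) = kξ − k/(2k² + 1/2)`. -/
noncomputable def thetaCH (ξ : ℝ) (k : ℂ) : ℂ :=
  k * (ξ : ℂ) - k / (2 * k ^ 2 + 1 / 2)

theorem thetaCH_im (ξ u v : ℝ) :
    (thetaCH ξ (u + v * Complex.I)).im =
      v * (ξ + (2 * (u ^ 2 + v ^ 2) - 1 / 2) /
        (4 * (u ^ 2 + v ^ 2) ^ 2 + 1 / 4 + 2 * (u ^ 2 - v ^ 2))) := by
  have hden : (2 * ((u : ℂ) + v * Complex.I) ^ 2 + 1 / 2) =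
      ⟨2 * (u ^ 2 - v ^ 2) + 1 / 2, 4 * u * v⟩ := by
    apply Complex.ext <;> simp [pow_two] <;> ring
  have hk : (u : ℂ) + v * Complex.I = ⟨u, v⟩ := by
    apply Complex.ext <;> simp
  have hnorm : Complex.normSq ⟨2 * (u ^ 2 - v ^ 2) + 1 / 2, 4 * u * v⟩ =
      4 * (u ^ 2 + v ^ 2) ^ 2 + 1 / 4 + 2 * (u ^ 2 - v ^ 2) := by
    rw [Complex.normSq_mk]; ring
  rw [thetaCH, hden, hk, Complex.sub_im, Complex.div_im, hnorm]
  simp only [Complex.mul_im, Complex.ofReal_re, Complex.ofReal_im]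
  ring

theorem thetaCH_quotient_le_of_sector {φ u v : ℝ} (hφ : φ ∈ Set.Ioo 0 (Real.pi / 4))
    (h : |v| ≤ |u| * Real.tan φ) :
    (2 * (u ^ 2 + v ^ 2) - 1 / 2) / (4 * (u ^ 2 + v ^ 2) ^ 2 + 1 / 4 + 2 * (u ^ 2 - v ^ 2)) ≤
      1 / (1 + Real.cos (2 * φ) + Real.sqrt (2 * (1 + Real.cos (2 * φ)))) := by
  obtain ⟨h0, h1⟩ := hφ
  have hc : 0 < Real.cos φ := Real.cos_pos_of_mem_Ioo ⟨by linarith, by linarith⟩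
  have hc2 : 0 < Real.cos (2 * φ) := Real.cos_pos_of_mem_Ioo ⟨by linarith, by linarith⟩
  have hvu : |v| * Real.cos φ ≤ |u| * Real.sin φ := by
    calc |v| * Real.cos φ ≤ |u| * Real.tan φ * Real.cos φ := by gcongr
      _ = |u| * Real.sin φ := by rw [mul_assoc, Real.tan_mul_cos hc.ne']
  have hsq : v ^ 2 * Real.cos φ ^ 2 ≤ u ^ 2 * Real.sin φ ^ 2 := by
    have := pow_le_pow_left₀ (by positivity) hvu 2
    simpa only [mul_pow, sq_abs] using this
  have hsector : (u ^ 2 + v ^ 2) * Real.cos (2 * φ) ≤ u ^ 2 - v ^ 2 := by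
    have e : u ^ 2 - v ^ 2 - (u ^ 2 + v ^ 2) * Real.cos (2 * φ) =
        2 * (u ^ 2 * Real.sin φ ^ 2 - v ^ 2 * Real.cos φ ^ 2) := by
      rw [Real.cos_two_mul, Real.sin_sq]; ring
    linarith
  set c := Real.cos (2 * φ)
  set q := Real.sqrt (2 * (1 + c))
  have hq : q ^ 2 = 2 * (1 + c) := Real.sq_sqrt (by positivity)
  have hq0 : 0 ≤ q := Real.sqrt_nonneg _
  have hr : 0 ≤ (u ^ 2 + v ^ 2) * c := by positivity
  rw [div_le_div_iff₀ (by nlinarith [sq_nonneg (u ^ 2 + v ^ 2)]) (by positivity)]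
  have hce : c = q ^ 2 / 2 - 1 := by linarith
  rw [hce] at hsector ⊢
  nlinarith [sq_nonneg (4 * (u ^ 2 + v ^ 2) - 1 - q)]

/-- For `ξ < −1/4` and `φ ∈ (0, π/4)` with
`√(2(cos 2φ + 1)) > −1 + √(1 − 2/ξ)`, setting
`C(φ) = 1/(1 + cos 2φ + √(2(1 + cos 2φ)))`, one has
`Im θ_ξ(k) ≤ (Im k)·(ξ + C(φ))` on the sectors `Υ₁ ∪ Υ₂` (`v ≥ 0`, `v ≤ |u| tan φ`)
and `Im θ_ξ(k) ≥ (Im k)·(ξ + C(φ))` on the sectors `Υ₃ ∪ Υ₄` (`v ≤ 0`, `|v| ≤ |u| tan φ`). -/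
theorem stmt_2 (ξ φ : ℝ) (hξ : ξ < -(1 / 4)) (hφ : φ ∈ Set.Ioo 0 (Real.pi / 4))
    (hcond : Real.sqrt (2 * (Real.cos (2 * φ) + 1)) > -1 + Real.sqrt (1 - 2 / ξ)) :
    (∀ u v : ℝ, 0 ≤ v → v ≤ |u| * Real.tan φ →
      (thetaCH ξ (u + v * Complex.I)).im ≤
        v * (ξ + 1 / (1 + Real.cos (2 * φ) + Real.sqrt (2 * (1 + Real.cos (2 * φ)))))) ∧
    (∀ u v : ℝ, v ≤ 0 → |v| ≤ |u| * Real.tan φ →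
      (thetaCH ξ (u + v * Complex.I)).im ≥
        v * (ξ + 1 / (1 + Real.cos (2 * φ) + Real.sqrt (2 * (1 + Real.cos (2 * φ)))))) := by
  simp only [thetaCH_im]
  refine ⟨fun u v hv h => ?_, fun u v hv h => ?_⟩
  · refine mul_le_mul_of_nonneg_left (add_le_add_right ?_ ξ) hv
    exact thetaCH_quotient_le_of_sector hφ (by rwa [abs_of_nonneg hv])
  · exact mul_le_mul_of_nonpos_left (add_le_add_right (thetaCH_quotient_le_of_sector hφ h) ξ) hv
end

section
/- Let ξ > 2 and let φ ∈ (0, π/4) satisfy 1 − √(1 − 2/ξ) < √(2(cos 2φ + 1)) < 1 + √(1 − 2/ξ). Then there exists a constant c̃ > 0 (depending only on ξ and φ) such that Im θ_ξ(k) ≥ c̃·(Im k) for every k = u + iv with v ≥ 0 and v ≤ |u| tan φ (k ∈ Υ₁ ∪ Υ₂), and Im θ_ξ(k) ≤ c̃·(Im k) for every k = u + iv with v ≤ 0 and |v| ≤ |u| tan φ (k ∈ Υ₃ ∪ Υ₄). -/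
/-- The imaginary part of the phase function on the region `|Im k| ≤ |Re k|`, which is free of
poles. -/
theorem thetaCH_im_of_sq_le_sq (ξ : ℝ) {u v : ℝ} (h : v ^ 2 ≤ u ^ 2) :
    (thetaCH ξ (u + v * Complex.I)).im =
      v * (ξ - (1 / 2 - 2 * (u ^ 2 + v ^ 2)) /
        (4 * (u ^ 2 + v ^ 2) ^ 2 + 2 * (u ^ 2 - v ^ 2) + 1 / 4)) := by
  have hD : 0 < 4 * (u ^ 2 + v ^ 2) ^ 2 + 2 * (u ^ 2 - v ^ 2) + 1 / 4 := by
    nlinarith [sq_nonneg (u ^ 2 + v ^ 2)]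
  have hden : (2 * ((u : ℂ) + v * Complex.I) ^ 2 + 1 / 2) =
      ⟨2 * (u ^ 2 - v ^ 2) + 1 / 2, 4 * u * v⟩ := by
    apply Complex.ext <;> simp [pow_two] <;> ring
  have hnorm : Complex.normSq ⟨2 * (u ^ 2 - v ^ 2) + 1 / 2, 4 * u * v⟩ =
      4 * (u ^ 2 + v ^ 2) ^ 2 + 2 * (u ^ 2 - v ^ 2) + 1 / 4 := by
    rw [Complex.normSq_mk]
    ring
  rw [thetaCH, hden, Complex.sub_im, Complex.div_im, hnorm]
  simp only [Complex.add_re, Complex.add_im, Complex.mul_re, Complex.mul_im, Complex.ofReal_re,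
    Complex.ofReal_im, Complex.I_re, Complex.I_im]
  field_simp
  ring

/-- On the region `|Im k| ≤ |Re k|` the quotient `Im θ_ξ(k) / Im k` is at least `ξ - 2`. -/
theorem exists_thetaCH_im_eq_mul (ξ : ℝ) {u v : ℝ} (h : v ^ 2 ≤ u ^ 2) :
    ∃ g : ℝ, ξ - 2 ≤ g ∧ (thetaCH ξ (u + v * Complex.I)).im = v * g := by
  refine ⟨_, ?_, thetaCH_im_of_sq_le_sq ξ h⟩
  have hD : 0 < 4 * (u ^ 2 + v ^ 2) ^ 2 + 2 * (u ^ 2 - v ^ 2) + 1 / 4 := by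
    nlinarith [sq_nonneg (u ^ 2 + v ^ 2)]
  gcongr
  rw [div_le_iff₀ hD]
  nlinarith [sq_nonneg (u ^ 2 + v ^ 2), sq_nonneg u, sq_nonneg v]

/-- For `ξ > 2` and `φ ∈ (0, π/4)` with
`1 − √(1 − 2/ξ) < √(2(cos 2φ + 1)) < 1 + √(1 − 2/ξ)`, there is a constant `c̃ > 0` such that
`Im θ_ξ(k) ≥ c̃·(Im k)` on `Υ₁ ∪ Υ₂` (`v ≥ 0`, `v ≤ |u| tan φ`) and
`Im θ_ξ(k) ≤ c̃·(Im k)` on `Υ₃ ∪ Υ₄` (`v ≤ 0`, `|v| ≤ |u| tan φ`). -/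
theorem stmt_5 (ξ φ : ℝ) (hξ : 2 < ξ) (hφ : φ ∈ Set.Ioo 0 (Real.pi / 4))
    (hcond₁ : 1 - Real.sqrt (1 - 2 / ξ) < Real.sqrt (2 * (Real.cos (2 * φ) + 1)))
    (hcond₂ : Real.sqrt (2 * (Real.cos (2 * φ) + 1)) < 1 + Real.sqrt (1 - 2 / ξ)) :
    ∃ c : ℝ, 0 < c ∧
      (∀ u v : ℝ, 0 ≤ v → v ≤ |u| * Real.tan φ →
        (thetaCH ξ (u + v * Complex.I)).im ≥ c * v) ∧
      (∀ u v : ℝ, v ≤ 0 → |v| ≤ |u| * Real.tan φ →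
        (thetaCH ξ (u + v * Complex.I)).im ≤ c * v) := by
  have htan : Real.tan φ ≤ 1 := by
    rw [← Real.tan_pi_div_four]
    exact (Real.tan_lt_tan_of_lt_of_lt_pi_div_two (by linarith [hφ.1, Real.pi_pos])
      (by linarith [Real.pi_pos]) hφ.2).le
  have hsq : ∀ u v : ℝ, |v| ≤ |u| * Real.tan φ → v ^ 2 ≤ u ^ 2 := fun u v h =>
    sq_le_sq.2 (h.trans (mul_le_of_le_one_right (abs_nonneg u) htan))
  refine ⟨ξ - 2, by linarith, fun u v hv h => ?_, fun u v hv h => ?_⟩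
  · obtain ⟨g, hg, him⟩ := exists_thetaCH_im_eq_mul ξ (hsq u v (by rwa [abs_of_nonneg hv]))
    rw [him, mul_comm v g]
    exact mul_le_mul_of_nonneg_right hg hv
  · obtain ⟨g, hg, him⟩ := exists_thetaCH_im_eq_mul ξ (hsq u v h)
    rw [him, mul_comm v g]
    exact mul_le_mul_of_nonpos_right hg hv
end

section
/- Let ξ ∈ ℝ with ξ < −1/4 or ξ > 2. Then the phase function has no stationary phase point on the real line: for every real k, the derivative of the real function k ↦ θ_ξ(k) = kξ − k/(2k² + 1/2) is nonzero; equivalently, ξ ≠ (1/2 − 2k²)/(2k² + 1/2)² for every k ∈ ℝ. -/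
theorem hasDerivAt_phase (ξ k : ℝ) :
    HasDerivAt (fun x : ℝ => x * ξ - x / (2 * x ^ 2 + 1 / 2))
      (ξ - (1 / 2 - 2 * k ^ 2) / (2 * k ^ 2 + 1 / 2) ^ 2) k := by
  have hden : HasDerivAt (fun x : ℝ => 2 * x ^ 2 + 1 / 2) (4 * k) k :=
    (((hasDerivAt_pow 2 k).const_mul 2).add_const (1 / 2 : ℝ)).congr_deriv
      (by norm_num; ring)
  exact (((hasDerivAt_id' k).mul_const ξ).sub
    ((hasDerivAt_id' k).div hden (by positivity))).congr_deriv (by ring)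

theorem phase_critical_value_mem_Icc (k : ℝ) :
    (1 / 2 - 2 * k ^ 2) / (2 * k ^ 2 + 1 / 2) ^ 2 ∈ Set.Icc (-(1 / 4) : ℝ) 2 := by
  have hpos : (0 : ℝ) < (2 * k ^ 2 + 1 / 2) ^ 2 := by positivity
  constructor
  · rw [le_div_iff₀ hpos]
    nlinarith [sq_nonneg (k ^ 2 - 3 / 4)]
  · rw [div_le_iff₀ hpos]
    nlinarith [sq_nonneg k, sq_nonneg (k ^ 2)]

/-- For `ξ < −1/4` or `ξ > 2`, the phase function
`θ_ξ(k) = kξ − k/(2k² + 1/2)` has no stationary phase point on the real line: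
for every real `k` its derivative `ξ − (1/2 − 2k²)/(2k² + 1/2)²` is nonzero. -/
theorem stmt_6 (ξ : ℝ) (hξ : ξ < -(1 / 4) ∨ 2 < ξ) (k : ℝ) :
    deriv (fun x : ℝ => x * ξ - x / (2 * x ^ 2 + 1 / 2)) k ≠ 0 ∧
      ξ ≠ (1 / 2 - 2 * k ^ 2) / (2 * k ^ 2 + 1 / 2) ^ 2 := by
  have hne : ξ ≠ (1 / 2 - 2 * k ^ 2) / (2 * k ^ 2 + 1 / 2) ^ 2 := by
    obtain ⟨hlo, hhi⟩ := phase_critical_value_mem_Icc k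
    rcases hξ with h | h
    · exact (h.trans_le hlo).ne
    · exact (hhi.trans_lt h).ne'
  rw [(hasDerivAt_phase ξ k).deriv]
  exact ⟨sub_ne_zero.mpr hne, hne⟩
end

section
/- Let ξ ∈ ℝ with 0 < ξ < 2. Then the phase function θ_ξ has exactly two stationary phase points on the real line: there exists k₀ > 0 such that { k ∈ ℝ : θ_ξ'(k) = 0 } = { k₀, −k₀ }, where θ_ξ'(k) = ξ − (1/2 − 2k²)/(2k² + 1/2)². -/
/-- For `0 < ξ < 2`, the quadratic `ξ u² + u - 1` has a root larger than `1 / 2`. -/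
theorem exists_quadratic_root_gt_half {ξ : ℝ} (hξ₀ : 0 < ξ) (hξ₂ : ξ < 2) :
    ∃ u : ℝ, 1 / 2 < u ∧ ξ * u ^ 2 + u = 1 := by
  have hs : √(1 + 4 * ξ) ^ 2 = 1 + 4 * ξ := Real.sq_sqrt (by positivity)
  have hlt : 1 + ξ < √(1 + 4 * ξ) := Real.lt_sqrt_of_sq_lt (by nlinarith)
  generalize √(1 + 4 * ξ) = s at hs hlt
  refine ⟨(s - 1) / (2 * ξ), ?_, ?_⟩
  · rw [lt_div_iff₀ (by positivity)]
    linarith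
  · field_simp
    linear_combination hs

/-- For `0 < ξ < 2`, the phase function `θ_ξ(k) = kξ − k/(2k² + 1/2)` has
exactly two stationary phase points on the real line: there is `k₀ > 0` with
`{k : θ_ξ'(k) = 0} = {k₀, −k₀}`, where `θ_ξ'(k) = ξ − (1/2 − 2k²)/(2k² + 1/2)²`. -/
theorem stmt_7 (ξ : ℝ) (hξ₀ : 0 < ξ) (hξ₂ : ξ < 2) :
    ∃ k₀ : ℝ, 0 < k₀ ∧
      {k : ℝ | ξ - (1 / 2 - 2 * k ^ 2) / (2 * k ^ 2 + 1 / 2) ^ 2 = 0} =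
        {k₀, -k₀} := by
  obtain ⟨u, hu, hroot⟩ := exists_quadratic_root_gt_half hξ₀ hξ₂
  have hsq : √((u - 1 / 2) / 2) ^ 2 = (u - 1 / 2) / 2 := Real.sq_sqrt (by linarith)
  refine ⟨√((u - 1 / 2) / 2), Real.sqrt_pos.2 (by linarith), ?_⟩
  ext k
  simp only [Set.mem_ofPred_eq, Set.mem_insert_iff, Set.mem_singleton_iff]
  rw [← sq_eq_sq_iff_eq_or_eq_neg, hsq, sub_eq_zero, eq_div_iff (by positivity)]
  constructor
  · intro h
    have hfac : (2 * k ^ 2 + 1 / 2 - u) * (ξ * (2 * k ^ 2 + 1 / 2 + u) + 1) = 0 := by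
      linear_combination h - hroot
    have hpos : 0 < ξ * (2 * k ^ 2 + 1 / 2 + u) + 1 := by positivity
    linarith [(mul_eq_zero.1 hfac).resolve_right hpos.ne']
  · intro h
    rw [h]
    linear_combination hroot
end

section
/- Let ξ ∈ ℝ with −1/4 < ξ < 0. Then the phase function θ_ξ has exactly four stationary phase points on the real line: there exist real numbers k₁ > k₂ > 0 such that { k ∈ ℝ : θ_ξ'(k) = 0 } = { k₁, k₂, −k₂, −k₁ }, where θ_ξ'(k) = ξ − (1/2 − 2k²)/(2k² + 1/2)². -/
/-- For `−1/4 < ξ < 0`, the phase function `θ_ξ(k) = kξ − k/(2k² + 1/2)` has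
exactly four stationary phase points on the real line: there are `k₁ > k₂ > 0` with
`{k : θ_ξ'(k) = 0} = {k₁, k₂, −k₂, −k₁}`, where `θ_ξ'(k) = ξ − (1/2 − 2k²)/(2k² + 1/2)²`. -/
theorem stmt_8 (ξ : ℝ) (hξ₀ : -(1 / 4) < ξ) (hξ₂ : ξ < 0) :
    ∃ k₁ k₂ : ℝ, k₂ < k₁ ∧ 0 < k₂ ∧
      {k : ℝ | ξ - (1 / 2 - 2 * k ^ 2) / (2 * k ^ 2 + 1 / 2) ^ 2 = 0} =
        {k₁, k₂, -k₂, -k₁} := by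
  obtain ⟨s, hs₀, hs⟩ : ∃ s : ℝ, 0 < s ∧ s ^ 2 = 1 + 4 * ξ :=
    ⟨√(1 + 4 * ξ), Real.sqrt_pos.mpr (by linarith), Real.sq_sqrt (by linarith)⟩
  have hs₁ : s < 1 := by nlinarith
  have hsub : 0 < 1 - s := by linarith
  have hadd : 0 < 1 + s := by linarith
  have ha : 0 < (3 + s) / (4 * (1 - s)) := by positivity
  have hb : 0 < (3 - s) / (4 * (1 + s)) := div_pos (by linarith) (by linarith)
  refine ⟨√((3 + s) / (4 * (1 - s))), √((3 - s) / (4 * (1 + s))), ?_, Real.sqrt_pos.mpr hb, ?_⟩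
  · apply Real.sqrt_lt_sqrt hb.le
    rw [div_lt_div_iff₀ (by linarith) (by linarith)]
    nlinarith
  have hξ : ξ = (s ^ 2 - 1) / 4 := by linarith
  ext k
  have hsqrt {a : ℝ} (h : 0 < a) : k ^ 2 = a ↔ k = √a ∨ k = -√a := by
    rw [← sq_eq_sq_iff_eq_or_eq_neg, Real.sq_sqrt h.le]
  have key : ξ - (1 / 2 - 2 * k ^ 2) / (2 * k ^ 2 + 1 / 2) ^ 2 = 0 ↔
      k ^ 2 = (3 + s) / (4 * (1 - s)) ∨ k ^ 2 = (3 - s) / (4 * (1 + s)) := by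
    have hu : (2 * k ^ 2 + 1 / 2) ^ 2 ≠ 0 := by positivity
    rw [sub_eq_zero, eq_div_iff hu, eq_div_iff (by positivity), eq_div_iff (by positivity),
      ← sub_eq_zero (a := k ^ 2 * (4 * (1 - s))), ← sub_eq_zero (a := k ^ 2 * (4 * (1 + s))),
      ← mul_eq_zero, hξ]
    constructor <;> intro h
    · linear_combination -16 * h
    · linear_combination -(1 / 16) * h
  simp only [Set.mem_ofPred_eq, Set.mem_insert_iff, Set.mem_singleton_iff]
  rw [key, hsqrt ha, hsqrt hb]
  tauto
end

section
/- Let N ≥ 1, let κ₁, …, κ_N be distinct positive reals, set kₙ = iκₙ, let d₁, …, d_N be nonzero complex numbers, and let αₙ, βₙ, γₙ, ζₙ (1 ≤ n ≤ N) be complex numbers. Define the 2×2-matrix-valued function M(k) = I + Σ_{n=1}^N [ [ γₙ/(k + kₙ), βₙ/(k − kₙ) ], [ ζₙ/(k + kₙ), αₙ/(k − kₙ) ] ] on ℂ ∖ {±k₁, …, ±k_N}. Then the following are equivalent: (i) for every n, lim_{k→kₙ} (k − kₙ)·M(k) = lim_{k→kₙ} M(k)·[[0, dₙ],[0, 0]]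 and lim_{k→−kₙ} (k + kₙ)·M(k) = lim_{k→−kₙ} M(k)·[[0, 0],[dₙ, 0]] (all limits taken in ℂ ∖ {±k₁,…,±k_N} and asserted to exist); (ii) for every n, βₙ = dₙ·( 1 + Σ_{h=1}^N γ_h/(kₙ + k_h) ), αₙ = dₙ·Σ_{h=1}^N ζ_h/(kₙ + k_h), γₙ = −dₙ·Σ_{h=1}^N β_h/(kₙ + k_h), and ζₙ = dₙ·( 1 − Σ_{h=1}^N α_h/(kₙ + k_h) ). -/
open Filter Topology

/-- The candidate reflectionless (N-soliton) model solution
`M(k) = I + Σₙ [[γₙ/(k+kₙ), βₙ/(k−kₙ)], [ζₙ/(k+kₙ), αₙ/(k−kₙ)]]` with `kₙ = iκₙ`. -/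
noncomputable def Msol (N : ℕ) (κ : Fin N → ℝ) (α β γ ζ : Fin N → ℂ) (k : ℂ) :
    Matrix (Fin 2) (Fin 2) ℂ :=
  1 + ∑ n : Fin N,
    !![γ n / (k + (κ n : ℂ) * Complex.I), β n / (k - (κ n : ℂ) * Complex.I);
       ζ n / (k + (κ n : ℂ) * Complex.I), α n / (k - (κ n : ℂ) * Complex.I)]

/-- The domain `ℂ ∖ {±k₁, …, ±k_N}` with `kₙ = iκₙ`. -/
def MsolDom (N : ℕ) (κ : Fin N → ℝ) : Set ℂ :=
  {k : ℂ | ∀ m : Fin N, k ≠ (κ m : ℂ) * Complex.I ∧ k ≠ -((κ m : ℂ) * Complex.I)}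

theorem exists_common_limit_iff {X Y : Type*} [TopologicalSpace Y] [T2Space Y] {l : Filter X}
    [l.NeBot] {f g : X → Y} {a b : Y} (hf : Tendsto f l (𝓝 a)) (hg : Tendsto g l (𝓝 b)) :
    (∃ L, Tendsto f l (𝓝 L) ∧ Tendsto g l (𝓝 L)) ↔ a = b := by
  constructor
  · rintro ⟨L, h₁, h₂⟩
    exact (tendsto_nhds_unique hf h₁).trans (tendsto_nhds_unique h₂ hg)
  · rintro rfl
    exact ⟨a, hf, hg⟩

theorem tendsto_matrix_fin_two {X R : Type*} [TopologicalSpace R] {l : Filter X}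
    {f₀₀ f₀₁ f₁₀ f₁₁ : X → R} {a₀₀ a₀₁ a₁₀ a₁₁ : R}
    (h₀₀ : Tendsto f₀₀ l (𝓝 a₀₀)) (h₀₁ : Tendsto f₀₁ l (𝓝 a₀₁))
    (h₁₀ : Tendsto f₁₀ l (𝓝 a₁₀)) (h₁₁ : Tendsto f₁₁ l (𝓝 a₁₁)) :
    Tendsto (fun x => !![f₀₀ x, f₀₁ x; f₁₀ x, f₁₁ x]) l (𝓝 !![a₀₀, a₀₁; a₁₀, a₁₁]) := by
  refine tendsto_pi_nhds.2 fun i => tendsto_pi_nhds.2 fun j => ?_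
  fin_cases i <;> fin_cases j <;> simpa

/-- A finite sum of simple fractions is continuous away from its poles. -/
theorem tendsto_sum_div_sub {ι : Type*} [Fintype ι] (c p : ι → ℂ) {z : ℂ} {s : Set ℂ}
    (hz : ∀ i, z ≠ p i) :
    Tendsto (fun k => ∑ i, c i / (k - p i)) (𝓝[s] z) (𝓝 (∑ i, c i / (z - p i))) :=
  tendsto_finsetSum _ fun i _ => (tendsto_const_nhds.div
    ((continuous_sub_right (p i)).tendsto z) (sub_ne_zero.2 (hz i))).mono_left nhdsWithin_le_nhds

/-- The residue of a finite sum of simple fractions at one of its poles. -/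
theorem tendsto_mul_sum_div_sub {ι : Type*} [Fintype ι] (c : ι → ℂ) {p : ι → ℂ}
    (hp : Function.Injective p) (n : ι) {s : Set ℂ} (hs : p n ∉ s) :
    Tendsto (fun k => (k - p n) * ∑ i, c i / (k - p i)) (𝓝[s] (p n)) (𝓝 (c n)) := by
  classical
  simp_rw [Finset.mul_sum]
  rw [show c n = ∑ i, if i = n then c n else 0 by simp]
  refine tendsto_finsetSum _ fun i _ => ?_
  split_ifs with h
  · subst h
    refine tendsto_const_nhds.congr' ?_
    filter_upwards [self_mem_nhdsWithin] with k hk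
    have : k - p i ≠ 0 := sub_ne_zero.2 fun h => hs (h ▸ hk)
    field_simp
  · have h₁ : Tendsto (fun k => k - p n) (𝓝 (p n)) (𝓝 0) := by
      simpa using (continuous_sub_right (p n)).tendsto (p n)
    have h₂ : Tendsto (fun k => c i / (k - p i)) (𝓝 (p n)) (𝓝 (c i / (p n - p i))) :=
      tendsto_const_nhds.div ((continuous_sub_right (p i)).tendsto _)
        (sub_ne_zero.2 fun e => h (hp e.symm))
    simpa using (h₁.mul h₂).mono_left nhdsWithin_le_nhds

theorem tendsto_sub_mul_zero {f : ℂ → ℂ} {z a : ℂ} {s : Set ℂ}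
    (hf : Tendsto f (𝓝[s] z) (𝓝 a)) : Tendsto (fun k => (k - z) * f k) (𝓝[s] z) (𝓝 0) := by
  have h : Tendsto (fun k => k - z) (𝓝[s] z) (𝓝 0) := by
    simpa using ((continuous_sub_right z).tendsto z).mono_left nhdsWithin_le_nhds
  simpa using h.mul hf

theorem dense_MsolDom (N : ℕ) (κ : Fin N → ℝ) : Dense (MsolDom N κ) := by
  have h : MsolDom N κ = (Set.range (fun m => (κ m : ℂ) * Complex.I) ∪
      Set.range (fun m => -((κ m : ℂ) * Complex.I)))ᶜ := by
    ext k
    simp [MsolDom, forall_and, eq_comm]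
  rw [h]
  exact ((Set.finite_range _).union (Set.finite_range _)).countable.dense_compl ℂ

theorem Msol_eq (N : ℕ) (κ : Fin N → ℝ) (α β γ ζ : Fin N → ℂ) (k : ℂ) :
    Msol N κ α β γ ζ k =
      !![1 + ∑ n, γ n / (k - -((κ n : ℂ) * Complex.I)), ∑ n, β n / (k - (κ n : ℂ) * Complex.I);
         ∑ n, ζ n / (k - -((κ n : ℂ) * Complex.I)),
         1 + ∑ n, α n / (k - (κ n : ℂ) * Complex.I)] := by
  ext i j
  fin_cases i <;> fin_cases j <;> simp [Msol, Matrix.sum_apply]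

/-- the residue conditions at `±kₙ` (existence and equality of the limits
`lim (k∓kₙ)·M(k)` and `lim M(k)·[[0,dₙ],[0,0]]` resp. `lim M(k)·[[0,0],[dₙ,0]]`, limits
taken in `ℂ ∖ {±k₁,…,±k_N}`) are equivalent to the linear algebraic system for
`αₙ, βₙ, γₙ, ζₙ`. -/
theorem stmt_11 (N : ℕ) (hN : 1 ≤ N) (κ : Fin N → ℝ) (hκpos : ∀ n, 0 < κ n)
    (hκinj : Function.Injective κ) (d : Fin N → ℂ) (hd : ∀ n, d n ≠ 0)
    (α β γ ζ : Fin N → ℂ) :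
    ((∀ n : Fin N,
        (∃ L : Matrix (Fin 2) (Fin 2) ℂ,
          Tendsto (fun k : ℂ => (k - (κ n : ℂ) * Complex.I) • Msol N κ α β γ ζ k)
            (𝓝[MsolDom N κ] ((κ n : ℂ) * Complex.I)) (𝓝 L) ∧
          Tendsto (fun k : ℂ => Msol N κ α β γ ζ k * !![0, d n; 0, 0])
            (𝓝[MsolDom N κ] ((κ n : ℂ) * Complex.I)) (𝓝 L)) ∧
        (∃ L : Matrix (Fin 2) (Fin 2) ℂ,
          Tendsto (fun k : ℂ => (k + (κ n : ℂ) * Complex.I) • Msol N κ α β γ ζ k)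
            (𝓝[MsolDom N κ] (-((κ n : ℂ) * Complex.I))) (𝓝 L) ∧
          Tendsto (fun k : ℂ => Msol N κ α β γ ζ k * !![0, 0; d n, 0])
            (𝓝[MsolDom N κ] (-((κ n : ℂ) * Complex.I))) (𝓝 L)))
      ↔
      (∀ n : Fin N,
        β n = d n * (1 + ∑ h : Fin N, γ h / ((κ n : ℂ) * Complex.I + (κ h : ℂ) * Complex.I)) ∧
        α n = d n * ∑ h : Fin N, ζ h / ((κ n : ℂ) * Complex.I + (κ h : ℂ) * Complex.I) ∧
        γ n = -d n * ∑ h : Fin N, β h / ((κ n : ℂ) * Complex.I + (κ h : ℂ) * Complex.I) ∧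
        ζ n = d n * (1 - ∑ h : Fin N, α h / ((κ n : ℂ) * Complex.I + (κ h : ℂ) * Complex.I)))) := by
  set p : Fin N → ℂ := fun m => (κ m : ℂ) * Complex.I with hp
  have hp_inj : Function.Injective p := fun a b h => hκinj (by simpa [hp] using h)
  have hq_inj : Function.Injective fun m => -p m := neg_injective.comp hp_inj
  have hpq : ∀ n m, p n ≠ -p m := fun n m h => by
    have h' : κ n = -κ m := by simpa [hp] using congrArg Complex.im h
    linarith [hκpos n, hκpos m]
  have hp_notMem : ∀ n, p n ∉ MsolDom N κ := fun n h => (h n).1 rfl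
  have hq_notMem : ∀ n, -p n ∉ MsolDom N κ := fun n h => (h n).2 rfl
  have hne : ∀ z, (𝓝[MsolDom N κ] z).NeBot := fun z =>
    mem_closure_iff_nhdsWithin_neBot.1 (dense_MsolDom N κ z)
  refine forall_congr' fun n => ?_
  have hγ := (tendsto_sum_div_sub γ (fun m => -p m) (s := MsolDom N κ) (hpq n)).const_add 1
  have hζ := tendsto_sum_div_sub ζ (fun m => -p m) (s := MsolDom N κ) (hpq n)
  have hβ := tendsto_sum_div_sub β p (s := MsolDom N κ) fun m => (hpq m n).symm
  have hα := (tendsto_sum_div_sub α p (s := MsolDom N κ) fun m => (hpq m n).symm).const_add 1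
  have hz {z : ℂ} : Tendsto (fun _ : ℂ => (0 : ℂ)) (𝓝[MsolDom N κ] z) (𝓝 0) := tendsto_const_nhds
  have hone {z : ℂ} := tendsto_sub_mul_zero
    (tendsto_const_nhds (x := (1 : ℂ)) (f := 𝓝[MsolDom N κ] z))
  have hL := tendsto_matrix_fin_two (tendsto_sub_mul_zero hγ)
    (tendsto_mul_sum_div_sub β hp_inj n (hp_notMem n)) (tendsto_sub_mul_zero hζ)
    (hone.add (tendsto_mul_sum_div_sub α hp_inj n (hp_notMem n)))
  have hR := tendsto_matrix_fin_two hz (hγ.mul_const (d n)) hz (hζ.mul_const (d n))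
  have hL' := tendsto_matrix_fin_two
    (hone.add (tendsto_mul_sum_div_sub γ hq_inj n (hq_notMem n))) (tendsto_sub_mul_zero hβ)
    (tendsto_mul_sum_div_sub ζ hq_inj n (hq_notMem n)) (tendsto_sub_mul_zero hα)
  have hR' := tendsto_matrix_fin_two (hβ.mul_const (d n)) hz (hα.mul_const (d n)) hz
  have hneg : ∀ c : Fin N → ℂ, ∑ h, c h / (-p n - p h) = -∑ h, c h / (p n + p h) := fun c => by
    rw [← Finset.sum_neg_distrib]
    exact Finset.sum_congr rfl fun h _ => by rw [← div_neg, neg_add']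
  rw [← and_assoc (a := β n = _)]
  refine and_congr ?_ ?_
  · convert exists_common_limit_iff hL hR using 1
    · simp [Msol_eq, Matrix.smul_of, mul_add, p]
    · simp [mul_comm, p]
  · convert exists_common_limit_iff hL' hR' using 1
    · simp [Msol_eq, Matrix.smul_of, mul_add, p]
    · simp only [hneg]
      simp [mul_comm, sub_eq_add_neg, p]
end

section
/- Let c > 0 and p > 2, and let q be the conjugate exponent, 1/p + 1/q = 1. There exists a constant C > 0 (depending only on c and p) such that for every b > 0 and every t > 0, ∫_0^∞ e^{−ctv} · v^{1/p − 1/2} · |v − b|^{1/q − 1} dv ≤ C · t^{−1/2}. -/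
open MeasureTheory

/-- The product `x ^ α * y ^ β` with nonpositive exponents, damped by `e ^ (-a x)`, is controlled by
the smaller of `x` and `y`. -/
lemma exp_mul_rpow_mul_rpow_le {a α β x y : ℝ} (ha : 0 ≤ a) (hα : α ≤ 0) (hβ : β < 0)
    (hx : 0 < x) (hy : 0 ≤ y) :
    Real.exp (-a * x) * x ^ α * y ^ β ≤
      Real.exp (-a * x) * x ^ (α + β) + Real.exp (-a * y) * y ^ (α + β) := by
  rcases hy.eq_or_lt with rfl | hy
  · rw [Real.zero_rpow hβ.ne, mul_zero]
    positivity
  rcases le_total x y with h | h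
  · have h1 : y ^ β ≤ x ^ β := Real.rpow_le_rpow_of_nonpos hx h hβ.le
    calc Real.exp (-a * x) * x ^ α * y ^ β ≤ Real.exp (-a * x) * x ^ α * x ^ β := by gcongr
      _ = Real.exp (-a * x) * x ^ (α + β) := by rw [Real.rpow_add hx, mul_assoc]
      _ ≤ _ := le_add_of_nonneg_right (by positivity)
  · have h1 : x ^ α ≤ y ^ α := Real.rpow_le_rpow_of_nonpos hy h hα
    have h2 : Real.exp (-a * x) ≤ Real.exp (-a * y) := Real.exp_le_exp.2 (by nlinarith)
    calc Real.exp (-a * x) * x ^ α * y ^ β ≤ Real.exp (-a * y) * y ^ α * y ^ β := by gcongr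
      _ = Real.exp (-a * y) * y ^ (α + β) := by rw [Real.rpow_add hy, mul_assoc]
      _ ≤ _ := le_add_of_nonneg_left (by positivity)

lemma integrableOn_exp_neg_mul_mul_rpow {a s : ℝ} (ha : 0 < a) (hs : -1 < s) :
    IntegrableOn (fun u : ℝ => Real.exp (-a * u) * u ^ s) (Set.Ioi 0) := by
  have h := integrableOn_rpow_mul_exp_neg_mul_rpow hs one_pos ha
  simpa only [Real.rpow_one, mul_comm] using h

lemma integral_exp_neg_mul_mul_rpow {a s : ℝ} (ha : 0 < a) (hs : -1 < s) :
    ∫ u in Set.Ioi (0 : ℝ), Real.exp (-a * u) * u ^ s =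
      (1 / a) ^ (s + 1) * Real.Gamma (s + 1) := by
  rw [← Real.integral_rpow_mul_exp_neg_mul_Ioi (by linarith : 0 < s + 1) ha]
  simp only [add_sub_cancel_right, neg_mul, mul_comm (Real.exp _)]

lemma integrable_comp_abs_of_integrableOn_Ioi {f : ℝ → ℝ} (hf : IntegrableOn f (Set.Ioi 0)) :
    Integrable fun x => f |x| := by
  have hpos : IntegrableOn (fun x => f |x|) (Set.Ioi 0) :=
    hf.congr_fun (fun x hx => by rw [abs_of_pos (Set.mem_Ioi.1 hx)]) measurableSet_Ioi
  have hneg : IntegrableOn (fun x => f |x|) (Set.Iic 0) := by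
    have h : IntegrableOn (fun x => f |x|) (Set.Ici (-0)) := by
      rwa [neg_zero, integrableOn_Ici_iff_integrableOn_Ioi]
    simpa only [abs_neg] using h.comp_neg_Iic
  rw [← integrableOn_univ, ← Set.Iic_union_Ioi (a := (0 : ℝ))]
  exact hneg.union hpos

theorem stmt_17 (c p q : ℝ) (hc : 0 < c) (hp : 2 < p) (hpq : 1 / p + 1 / q = 1) :
    ∃ C : ℝ, 0 < C ∧ ∀ b : ℝ, 0 < b → ∀ t : ℝ, 0 < t →
      (∫ v in Set.Ioi (0 : ℝ),
          Real.exp (-c * t * v) * v ^ (1 / p - 1 / 2) * |v - b| ^ (1 / q - 1)) ≤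
        C * t ^ (-(1 : ℝ) / 2) := by
  have hp0 : 0 < 1 / p := by positivity
  have hp2 : 1 / p < 1 / 2 := one_div_lt_one_div_of_lt two_pos hp
  have hsum : 1 / p - 1 / 2 + (1 / q - 1) = -1 / 2 := by linarith
  have hΓ : 0 < Real.Gamma (1 / 2) := Real.Gamma_pos_of_pos (by norm_num)
  refine ⟨4 * (c ^ (-(1 : ℝ) / 2) * Real.Gamma (1 / 2)), by positivity, fun b _ t ht => ?_⟩
  have hct : 0 < c * t := mul_pos hc ht
  set g : ℝ → ℝ := fun u => Real.exp (-(c * t) * |u|) * |u| ^ (-(1 : ℝ) / 2) with hg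
  have hg_nonneg : ∀ u, 0 ≤ g u := fun u => by positivity
  have hg_int : Integrable g := integrable_comp_abs_of_integrableOn_Ioi
    (integrableOn_exp_neg_mul_mul_rpow hct (by norm_num))
  have hgb_int : Integrable fun v => g (v - b) := hg_int.comp_sub_right b
  have hg_integral : ∫ u, g u = 2 * (c ^ (-(1 : ℝ) / 2) * Real.Gamma (1 / 2) *
      t ^ (-(1 : ℝ) / 2)) := by
    rw [hg, integral_comp_abs (f := fun u : ℝ => Real.exp (-(c * t) * u) * u ^ (-(1 : ℝ) / 2)),
      integral_exp_neg_mul_mul_rpow hct (by norm_num), one_div (c * t),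
      Real.inv_rpow hct.le, ← Real.rpow_neg hct.le, Real.mul_rpow hc.le ht.le]
    norm_num
    ring
  calc _ ≤ ∫ v in Set.Ioi (0 : ℝ), (g v + g (v - b)) := by
        refine integral_mono_of_nonneg ?_ (hg_int.add hgb_int).integrableOn ?_
        · filter_upwards [ae_restrict_mem measurableSet_Ioi] with v hv
          have hv : 0 < v := hv
          simp only [Pi.zero_apply]
          positivity
        · filter_upwards [ae_restrict_mem measurableSet_Ioi] with v hv
          have hv : 0 < v := hv
          have h := exp_mul_rpow_mul_rpow_le hct.le (by linarith : 1 / p - 1 / 2 ≤ 0)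
            (by linarith : 1 / q - 1 < 0) hv (abs_nonneg (v - b))
          rw [hsum] at h
          simpa only [hg, abs_of_pos hv, neg_mul] using h
    _ ≤ ∫ v, (g v + g (v - b)) :=
        setIntegral_le_integral (hg_int.add hgb_int)
          (Filter.Eventually.of_forall fun v => add_nonneg (hg_nonneg v) (hg_nonneg (v - b)))
    _ = 2 * ∫ u, g u := by
        rw [integral_add hg_int hgb_int, integral_sub_right_eq_self g b, two_mul]
    _ = _ := by rw [hg_integral]; ring
end

section
/- Let ρ ∈ (0, 1/4) and c > 0. There exists a constant C > 0 (depending only on ρ and c) such that for every t ≥ 1, ∫_0^{1/4} e^{−ctv} ( ∫_v^∞ (u² + v²)^{−1/2 − ρ} · (u² + (v − 1/2)²)^{−1/2 + ρ} du ) dv ≤ C · t^{−1 + 2ρ}. -/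
open MeasureTheory

/-- At height `v ∈ (0, 1/4)`, the integral over the half-line `u > v` is bounded by a constant
multiple of `v ^ (-2ρ)`. -/
lemma setIntegral_Ioi_kernel_le {ρ v : ℝ} (hρ : ρ ∈ Set.Ioo (0 : ℝ) (1 / 4))
    (hv : v ∈ Set.Ioo (0 : ℝ) (1 / 4)) :
    ∫ u in Set.Ioi v,
        (u ^ 2 + v ^ 2) ^ (-(1 : ℝ) / 2 - ρ) *
          (u ^ 2 + (v - 1 / 2) ^ 2) ^ (-(1 : ℝ) / 2 + ρ) ≤
      (1 / 8 : ℝ) ^ (-(1 : ℝ) / 2 + ρ) / (2 * ρ) * v ^ (-2 * ρ) := by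
  obtain ⟨hρ0, hρ1⟩ := hρ
  obtain ⟨hv0, -⟩ := hv
  have ha : -1 - 2 * ρ < -1 := by linarith
  calc
    _ ≤ ∫ u in Set.Ioi v, u ^ (-1 - 2 * ρ) * (1 / 8 : ℝ) ^ (-(1 : ℝ) / 2 + ρ) := by
      refine integral_mono_of_nonneg (Filter.Eventually.of_forall fun u ↦ by positivity)
        ((integrableOn_Ioi_rpow_of_lt ha hv0).mul_const _)
        (ae_restrict_of_forall_mem measurableSet_Ioi fun u hu ↦ ?_)
      have hvu : v < u := hu
      have hu0 : 0 < u := hv0.trans hvu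
      have h_pow : u ^ (-1 - 2 * ρ) = (u ^ 2) ^ (-(1 : ℝ) / 2 - ρ) := by
        rw [← Real.rpow_natCast, ← Real.rpow_mul hu0.le]
        congr 1
        push_cast
        ring
      dsimp only
      rw [h_pow]
      gcongr ?_ * ?_
      · exact Real.rpow_le_rpow_of_nonpos (by positivity) (by nlinarith) (by linarith)
      · exact Real.rpow_le_rpow_of_nonpos (by norm_num)
          (by nlinarith [sq_nonneg (v - 1 / 4)]) (by linarith)
    _ = _ := by
      rw [integral_mul_const, integral_Ioi_rpow_of_lt ha hv0,
        show -1 - 2 * ρ + 1 = -2 * ρ by ring]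
      field_simp

/-- for `ρ ∈ (0, 1/4)` and `c > 0` there is `C > 0` such that for all `t ≥ 1`,
`∫_0^{1/4} e^{−ctv} (∫_v^∞ (u² + v²)^{−1/2 − ρ} (u² + (v − 1/2)²)^{−1/2 + ρ} du) dv
  ≤ C t^{−1 + 2ρ}`. -/
theorem stmt_18 (ρ c : ℝ) (hρ : ρ ∈ Set.Ioo (0 : ℝ) (1 / 4)) (hc : 0 < c) :
    ∃ C : ℝ, 0 < C ∧ ∀ t : ℝ, 1 ≤ t →
      (∫ v in Set.Ioo (0 : ℝ) (1 / 4),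
          Real.exp (-c * t * v) *
            ∫ u in Set.Ioi v,
              (u ^ 2 + v ^ 2) ^ (-(1 : ℝ) / 2 - ρ) *
                (u ^ 2 + (v - 1 / 2) ^ 2) ^ (-(1 : ℝ) / 2 + ρ)) ≤
        C * t ^ (-1 + 2 * ρ) := by
  have hρ0 := hρ.1
  have hρ1 := hρ.2
  have hΓ : 0 < Real.Gamma (1 - 2 * ρ) := Real.Gamma_pos_of_pos (by linarith)
  set K : ℝ := (1 / 8 : ℝ) ^ (-(1 : ℝ) / 2 + ρ) / (2 * ρ)
  have hK0 : 0 < K := by positivity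
  refine ⟨K * (c ^ (-1 + 2 * ρ) * Real.Gamma (1 - 2 * ρ)), by positivity, fun t ht ↦ ?_⟩
  have ht0 : 0 < t := by linarith
  have hct : 0 < c * t := by positivity
  have h_int : IntegrableOn (fun v : ℝ ↦ K * (v ^ (-2 * ρ) * Real.exp (-(c * t * v))))
      (Set.Ioi 0) := by
    have h := integrableOn_rpow_mul_exp_neg_mul_rpow (s := -2 * ρ) (p := 1) (by linarith)
      one_pos hct
    simp only [Real.rpow_one, neg_mul] at h ⊢
    exact h.const_mul K
  calc
    _ ≤ ∫ v in Set.Ioo (0 : ℝ) (1 / 4), K * (v ^ (-2 * ρ) * Real.exp (-(c * t * v))) := by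
      refine integral_mono_of_nonneg
        (Filter.Eventually.of_forall fun v ↦
          mul_nonneg (Real.exp_pos _).le (integral_nonneg fun u ↦ by positivity))
        (h_int.mono_set Set.Ioo_subset_Ioi_self)
        (ae_restrict_of_forall_mem measurableSet_Ioo fun v hv ↦ ?_)
      calc
        _ ≤ Real.exp (-c * t * v) * (K * v ^ (-2 * ρ)) :=
          mul_le_mul_of_nonneg_left (setIntegral_Ioi_kernel_le hρ hv) (Real.exp_pos _).le
        _ = _ := by
          rw [show -c * t * v = -(c * t * v) by ring]
          ring
    _ ≤ ∫ v in Set.Ioi (0 : ℝ), K * (v ^ (-2 * ρ) * Real.exp (-(c * t * v))) := by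
      refine setIntegral_mono_set h_int
        (ae_restrict_of_forall_mem measurableSet_Ioi fun v hv ↦ ?_)
        Set.Ioo_subset_Ioi_self.eventuallyLE
      have hv0 : 0 < v := hv
      dsimp only [Pi.zero_apply]
      positivity
    _ = _ := by
      have h := Real.integral_rpow_mul_exp_neg_mul_Ioi (a := 1 - 2 * ρ) (by linarith) hct
      rw [show 1 - 2 * ρ - 1 = -2 * ρ by ring] at h
      rw [integral_const_mul, h, one_div, Real.inv_rpow hct.le, ← Real.rpow_neg hct.le,
        show -(1 - 2 * ρ) = -1 + 2 * ρ by ring, Real.mul_rpow hc.le ht0.le]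
      ring
end
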